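/- Let k ≥ 0 and n̄ = (n_1,…,n_r) with r ≥ 1 and n_i ≥ 1 for all i. Suppose that 2(k+1) = Σ_{i∈[r]} n_i and that k+1 is not representable as a sum of a subset of {n_1,…,n_r}, i.e. there is no T ⊆ [r] with Σ_{i∈T} n_i = k+1. Then every (k,n̄)-PPSN polytope has dimension at least Σ_{i∈[r]} n_i (and hence the smallest dimension of a (k,n̄)-PPSN polytope equals Σ_{i∈[r]} n_i). -/

import Mathlib

open Set

section PolytopeDefs

variable {E : Type*} [AddCommGroup E] [Module ℝ E]
variable {E' : Type*} [AddCommGroup E'] [Module ℝ E']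

/-- A polytope: the convex hull of a finite set of points. -/
def IsPolytope (P : Set E) : Prop :=
  ∃ V : Finset E, P = convexHull ℝ (V : Set E)

/-- The dimension of a set of points: the dimension of its affine span. -/
noncomputable def polyDim (P : Set E) : ℕ :=
  Module.finrank ℝ (affineSpan ℝ P).direction

/-- A nonempty exposed face of `P`: a nonempty set of the form
`{x ∈ P | ⟨c,x⟩ = max_{y ∈ P} ⟨c,y⟩}` for a linear functional `c`. -/
def IsFace (P F : Set E) : Prop :=
  F.Nonempty ∧ ∃ c : E →ₗ[ℝ] ℝ, F = {x ∈ P | ∀ y ∈ P, c y ≤ c x}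

/-- The `k`-skeleton of `P`: its nonempty faces of dimension at most `k`. -/
def skel (k : ℕ) (P : Set E) : Set (Set E) :=
  {F | IsFace P F ∧ polyDim F ≤ k}

/-- The set of all nonempty faces of `P`. -/
def facesOf (P : Set E) : Set (Set E) :=
  {F | IsFace P F}

/-- Combinatorial equivalence of `k`-skeletons: the posets of faces of dimension
at most `k`, ordered by inclusion, are order-isomorphic. -/
def SkelEquiv (k : ℕ) (P : Set E) (Q : Set E') : Prop :=
  Nonempty (skel k P ≃o skel k Q)

end PolytopeDefs

/-- The product of standard simplices `Δ_{n 0} × ⋯ × Δ_{n (r-1)}`. -/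
def prodSimplex {r : ℕ} (n : Fin r → ℕ) : Set ((i : Fin r) → Fin (n i + 1) → ℝ) :=
  Set.univ.pi fun i => stdSimplex ℝ (Fin (n i + 1))

/-- `P` is `(k, n̄)`-prodsimplicial-neighborly: it is a polytope whose `k`-skeleton
is combinatorially equivalent to that of the product of simplices `Δ_n̄`. -/
def IsPSN {E : Type*} [AddCommGroup E] [Module ℝ E] (k : ℕ) {r : ℕ} (n : Fin r → ℕ)
    (P : Set E) : Prop :=
  IsPolytope P ∧ SkelEquiv k P (prodSimplex n)

/-- `P` is `(k, n̄)`-projected-prodsimplicial-neighborly: it is `(k, n̄)`-PSN and moreover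
the image under a linear map of a polytope whose poset of all nonempty faces is
order-isomorphic to that of `Δ_n̄`. -/
def IsPPSN {E : Type*} [AddCommGroup E] [Module ℝ E] (k : ℕ) {r : ℕ} (n : Fin r → ℕ)
    (P : Set E) : Prop :=
  IsPSN k n P ∧ ∃ (N : ℕ) (Q : Set (Fin N → ℝ)) (f : (Fin N → ℝ) →ₗ[ℝ] E),
    IsPolytope Q ∧ P = f '' Q ∧ Nonempty (facesOf Q ≃o facesOf (prodSimplex n))

section Faces

variable {E : Type*} [AddCommGroup E] [Module ℝ E]
variable {E' : Type*} [AddCommGroup E'] [Module ℝ E']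

theorem IsFace.subset {P F : Set E} (h : IsFace P F) : F ⊆ P := by
  obtain ⟨-, c, rfl⟩ := h
  exact fun x hx => hx.1

theorem IsFace.exists_functional {P F : Set E} (h : IsFace P F) :
    ∃ (c : E →ₗ[ℝ] ℝ) (m : ℝ), (∀ x ∈ P, c x ≤ m) ∧ ∀ x ∈ P, x ∈ F ↔ c x = m := by
  obtain ⟨⟨p, hp⟩, c, rfl⟩ := h
  refine ⟨c, c p, fun x hx => hp.2 x hx, fun x hx => ⟨fun h => ?_, fun h => ⟨hx, fun y hy => ?_⟩⟩⟩
  · exact le_antisymm (hp.2 x hx) (h.2 p hp.1)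
  · rw [h]; exact hp.2 y hy

theorem isFace_of_functional {P F : Set E} (hne : F.Nonempty) (hF : F ⊆ P) (c : E →ₗ[ℝ] ℝ)
    (m : ℝ) (hle : ∀ x ∈ P, c x ≤ m) (hiff : ∀ x ∈ P, x ∈ F ↔ c x = m) : IsFace P F := by
  refine ⟨hne, c, ?_⟩
  ext x
  constructor
  · intro hx
    refine ⟨hF hx, fun y hy => ?_⟩
    rw [(hiff x (hF hx)).1 hx]
    exact hle y hy
  · rintro ⟨hx, hmax⟩
    obtain ⟨p, hp⟩ := hne
    refine (hiff x hx).2 (le_antisymm (hle x hx) ?_)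
    rw [← (hiff p (hF hp)).1 hp]
    exact hmax p (hF hp)

theorem IsFace.inter {P F G : Set E} (hF : IsFace P F) (hG : IsFace P G)
    (hne : (F ∩ G).Nonempty) : IsFace P (F ∩ G) := by
  obtain ⟨c, m, hc, hc'⟩ := hF.exists_functional
  obtain ⟨d, l, hd, hd'⟩ := hG.exists_functional
  refine isFace_of_functional hne (fun x hx => hF.subset hx.1) (c + d) (m + l)
    (fun x hx => add_le_add (hc x hx) (hd x hx)) fun x hx => ?_
  rw [mem_inter_iff, hc' x hx, hd' x hx, LinearMap.add_apply]
  have := hc x hx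
  have := hd x hx
  constructor
  · rintro ⟨h, h'⟩
    rw [h, h']
  · intro h
    constructor <;> linarith

theorem IsFace.preimage {Q : Set E} {F : Set E'} (f : E →ₗ[ℝ] E') (hF : IsFace (f '' Q) F) :
    IsFace Q (Q ∩ f ⁻¹' F) := by
  obtain ⟨c, m, hc, hc'⟩ := hF.exists_functional
  refine isFace_of_functional ?_ inter_subset_left (c ∘ₗ f) m
    (fun x hx => hc _ ⟨x, hx, rfl⟩) fun x hx => ?_
  · obtain ⟨p, hp⟩ := hF.1
    obtain ⟨q, hq, rfl⟩ := hF.subset hp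
    exact ⟨q, hq, hp⟩
  · rw [LinearMap.comp_apply, ← hc' (f x) ⟨x, hx, rfl⟩]
    exact ⟨fun h => h.2, fun h => ⟨hx, h⟩⟩

theorem IsFace.convex {P F : Set E} (hP : Convex ℝ P) (hF : IsFace P F) : Convex ℝ F := by
  obtain ⟨c, m, hc, hc'⟩ := hF.exists_functional
  intro x hx y hy a b ha hb hab
  have hx' := (hc' x (hF.subset hx)).1 hx
  have hy' := (hc' y (hF.subset hy)).1 hy
  refine (hc' _ (hP (hF.subset hx) (hF.subset hy) ha hb hab)).2 ?_
  rw [map_add, map_smul, map_smul, hx', hy', smul_eq_mul, smul_eq_mul, ← add_mul, hab, one_mul]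

theorem polyDim_mono [FiniteDimensional ℝ E] {F G : Set E} (h : F ⊆ G) :
    polyDim F ≤ polyDim G :=
  Submodule.finrank_mono (AffineSubspace.direction_le (affineSpan_mono ℝ h))

/-- A functional with constant value on a set is constant on the affine span. -/
theorem eq_of_mem_affineSpan {P : Set E} (c : E →ₗ[ℝ] ℝ) (m : ℝ) (h : ∀ x ∈ P, c x = m) {y : E}
    (hy : y ∈ affineSpan ℝ P) : c y = m := by
  have h1 : affineSpan ℝ P ≤ (affineSpan ℝ {m}).comap c.toAffineMap := by
    rw [affineSpan_le]
    intro x hx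
    simpa using h x hx
  simpa using h1 hy

theorem polyDim_lt_of_isFace [FiniteDimensional ℝ E] {P F G : Set E} (hF : IsFace P F)
    (hG : G ⊆ P) (h : F ⊂ G) : polyDim F < polyDim G := by
  obtain ⟨c, m, hc, hc'⟩ := hF.exists_functional
  obtain ⟨x, hx⟩ := hF.1
  obtain ⟨y, hy, hyF⟩ := exists_of_ssubset h
  refine Submodule.finrank_lt_finrank_of_lt
    (lt_of_le_of_ne (AffineSubspace.direction_le (affineSpan_mono ℝ h.1)) fun heq => ?_)
  have hmem : y - x ∈ (affineSpan ℝ F).direction := by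
    rw [heq]
    exact AffineSubspace.vsub_mem_direction (subset_affineSpan ℝ _ hy)
      (subset_affineSpan ℝ _ (h.1 hx))
  have hy' : y ∈ affineSpan ℝ F := by
    have := AffineSubspace.vadd_mem_of_mem_direction hmem (subset_affineSpan ℝ F hx)
    simpa using this
  exact hyF ((hc' y (hG hy)).2 (eq_of_mem_affineSpan c m
    (fun z hz => (hc' z (hF.subset hz)).1 hz) hy'))

theorem polyDim_image (f : E →ₗ[ℝ] E') (Q : Set E) :
    polyDim (f '' Q) = Module.finrank ℝ ((affineSpan ℝ Q).direction.map f) := by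
  have h : affineSpan ℝ (f '' Q) = (affineSpan ℝ Q).map f.toAffineMap := by
    rw [AffineSubspace.map_span]; rfl
  rw [polyDim, h, AffineSubspace.map_direction]
  rfl

/-- A linear map that lowers the dimension of a set kills a nonzero direction of it. -/
theorem exists_direction_of_polyDim_lt [FiniteDimensional ℝ E] (f : E →ₗ[ℝ] E') (Q : Set E)
    (h : polyDim (f '' Q) < polyDim Q) :
    ∃ w ∈ (affineSpan ℝ Q).direction, w ≠ 0 ∧ f w = 0 := by
  by_contra! hcon
  refine h.ne ?_
  rw [polyDim_image, polyDim]
  set D := (affineSpan ℝ Q).direction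
  have hinj : Function.Injective (f.domRestrict D) := by
    rw [← LinearMap.ker_eq_bot, LinearMap.ker_eq_bot']
    intro w hw
    by_contra hne
    exact hcon w w.2 (by simpa using hne) hw
  rw [← LinearMap.finrank_range_of_inj hinj, LinearMap.range_domRestrict]

end Faces

section FacetDescription

variable {E : Type*} [NormedAddCommGroup E] [NormedSpace ℝ E]

theorem le_on_convexHull {V : Set E} (c : E →ₗ[ℝ] ℝ) (m : ℝ) (h : ∀ v ∈ V, c v ≤ m) {x : E}
    (hx : x ∈ convexHull ℝ V) : c x ≤ m :=
  convexHull_min h (convex_halfSpace_le c.isLinear m) hx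

/-- If every proper face of a polytope lies in one of the proper faces cut out by the
inequalities `c t ≤ m t`, then these inequalities describe the polytope in its affine span. -/
theorem mem_convexHull_of_le {ι : Type*} (V : Finset E) (c : ι → E →ₗ[ℝ] ℝ) (m : ι → ℝ)
    (hle : ∀ t, ∀ x ∈ convexHull ℝ (V : Set E), c t x ≤ m t)
    (hproper : ∀ t, ∃ x ∈ convexHull ℝ (V : Set E), c t x < m t)
    (hcover : ∀ F, IsFace (convexHull ℝ (V : Set E)) F → F ≠ convexHull ℝ (V : Set E) →
      ∃ t, ∀ x ∈ F, c t x = m t)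
    {y : E} (hy : y ∈ affineSpan ℝ (convexHull ℝ (V : Set E))) (hym : ∀ t, c t y ≤ m t) :
    y ∈ convexHull ℝ (V : Set E) := by
  classical
  by_contra hyQ
  have hV : V.Nonempty := by
    rw [Finset.nonempty_iff_ne_empty]
    rintro rfl
    rw [Finset.coe_empty, convexHull_empty, AffineSubspace.span_empty] at hy
    exact AffineSubspace.notMem_bot ℝ E y hy
  have key : ∀ j : ℕ, ∃ (d : E →ₗ[ℝ] ℝ) (l : ℝ), (∀ v ∈ V, d v ≤ l) ∧ (∃ v ∈ V, d v = l) ∧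
      l < d y ∧ j ≤ (V.filter fun v => d v = l).card := by
    intro j
    induction j with
    | zero =>
      obtain ⟨g, u, hg, hu⟩ := geometric_hahn_banach_closed_point (convex_convexHull ℝ _)
        (V.finite_toSet.isCompact_convexHull (𝕜 := ℝ)).isClosed hyQ
      obtain ⟨v, hv, hmax⟩ := V.exists_max_image g hV
      exact ⟨g, g v, hmax, ⟨v, hv, rfl⟩, (hg v (subset_convexHull ℝ _ hv)).trans hu, Nat.zero_le _⟩
    | succ j ih =>
      obtain ⟨d, l, hd, ⟨v₀, hv₀, hv₀l⟩, hl, hj⟩ := ih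
      have hdQ : ∀ x ∈ convexHull ℝ (V : Set E), d x ≤ l := fun x hx => le_on_convexHull d l hd hx
      obtain ⟨t, ht⟩ := hcover {x ∈ convexHull ℝ (V : Set E) | d x = l}
        (isFace_of_functional ⟨v₀, subset_convexHull ℝ _ hv₀, hv₀l⟩ (fun x hx => hx.1) d l hdQ
          fun x hx => ⟨fun h => h.2, fun h => ⟨hx, h⟩⟩)
        (fun heq => hl.ne' (eq_of_mem_affineSpan d l (fun x hx => by
          rw [← heq] at hx; exact hx.2) hy))
      have hmV : ∀ v ∈ V, c t v ≤ m t := fun v hv => hle t v (subset_convexHull ℝ _ hv)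
      have hne : (V.filter fun v => c t v < m t).Nonempty := by
        by_contra hemp
        rw [Finset.not_nonempty_iff_eq_empty, Finset.filter_eq_empty_iff] at hemp
        obtain ⟨x, hx, hxm⟩ := hproper t
        have : (-c t) x ≤ -m t := le_on_convexHull (-c t) (-m t)
          (fun v hv => by simpa using hemp hv) hx
        simp only [LinearMap.neg_apply] at this
        linarith
      obtain ⟨v₁, hv₁, hmin⟩ := Finset.exists_min_image _
        (fun v => (l - d v) / (m t - c t v)) hne
      obtain ⟨hv₁V, hv₁m⟩ := Finset.mem_filter.1 hv₁
      have hdv₁ : d v₁ < l := lt_of_le_of_ne (hd v₁ hv₁V) fun h =>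
        hv₁m.ne (ht v₁ ⟨subset_convexHull ℝ _ hv₁V, h⟩)
      set s := (l - d v₁) / (m t - c t v₁) with hs
      have hspos : 0 < s := div_pos (sub_pos.2 hdv₁) (sub_pos.2 hv₁m)
      have hsv₁ : d v₁ - s * c t v₁ = l - s * m t := by
        have : s * (m t - c t v₁) = l - d v₁ := div_mul_cancel₀ _ (sub_pos.2 hv₁m).ne'
        linarith
      refine ⟨d - s • c t, l - s * m t, fun v hv => ?_, ⟨v₁, hv₁V, ?_⟩, ?_, ?_⟩
      · simp only [LinearMap.sub_apply, LinearMap.smul_apply, smul_eq_mul]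
        rcases (hmV v hv).lt_or_eq with h | h
        · have h1 := hmin v (Finset.mem_filter.2 ⟨hv, h⟩)
          rw [le_div_iff₀ (sub_pos.2 h)] at h1
          linarith
        · rw [h]
          linarith [hd v hv]
      · simpa using hsv₁
      · simp only [LinearMap.sub_apply, LinearMap.smul_apply, smul_eq_mul]
        nlinarith [hym t]
      · refine Nat.succ_le_of_lt (lt_of_le_of_lt hj (Finset.card_lt_card ?_))
        rw [Finset.ssubset_iff_of_subset]
        · refine ⟨v₁, by simpa [hv₁V] using hsv₁, by simp [hdv₁.ne]⟩
        · intro v hv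
          obtain ⟨hvV, hvl⟩ := Finset.mem_filter.1 hv
          simp [hvV, hvl, ht v ⟨subset_convexHull ℝ _ hvV, hvl⟩]
  obtain ⟨d, l, -, -, -, hcard⟩ := key (V.card + 1)
  have := Finset.card_filter_le V fun v => d v = l
  omega

/-- Under the same covering hypothesis, a direction that is compatible with the inequalities that
are tight at `x` is feasible at `x`. -/
theorem exists_add_smul_mem {ι : Type*} [Finite ι] (V : Finset E) (c : ι → E →ₗ[ℝ] ℝ) (m : ι → ℝ)
    (hle : ∀ t, ∀ x ∈ convexHull ℝ (V : Set E), c t x ≤ m t)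
    (hproper : ∀ t, ∃ x ∈ convexHull ℝ (V : Set E), c t x < m t)
    (hcover : ∀ F, IsFace (convexHull ℝ (V : Set E)) F → F ≠ convexHull ℝ (V : Set E) →
      ∃ t, ∀ x ∈ F, c t x = m t)
    {x w : E} (hx : x ∈ convexHull ℝ (V : Set E))
    (hw : w ∈ (affineSpan ℝ (convexHull ℝ (V : Set E))).direction)
    (htight : ∀ t, c t x = m t → c t w ≤ 0) :
    ∃ δ : ℝ, 0 < δ ∧ x + δ • w ∈ convexHull ℝ (V : Set E) := by
  have hev : ∀ᶠ δ : ℝ in nhdsWithin 0 (Ioi 0), ∀ t, c t x + δ * c t w ≤ m t := by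
    rw [Filter.eventually_all]
    intro t
    rcases (hle t x hx).lt_or_eq with h | h
    · have hcont : Filter.Tendsto (fun δ : ℝ => c t x + δ * c t w) (nhdsWithin 0 (Ioi 0))
          (nhds (c t x + 0 * c t w)) :=
        ((by fun_prop : Continuous fun δ : ℝ => c t x + δ * c t w).tendsto 0).mono_left
          nhdsWithin_le_nhds
      rw [zero_mul, add_zero] at hcont
      exact (hcont.eventually (gt_mem_nhds h)).mono fun δ h => le_of_lt h
    · filter_upwards [self_mem_nhdsWithin] with δ hδ
      nlinarith [htight t h, mem_Ioi.1 hδ]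
  obtain ⟨δ, hδ, hpos⟩ := (hev.and self_mem_nhdsWithin).exists
  refine ⟨δ, hpos, mem_convexHull_of_le V c m hle hproper hcover ?_ fun t => ?_⟩
  · rw [add_comm]
    exact AffineSubspace.vadd_mem_of_mem_direction (Submodule.smul_mem _ _ hw)
      (subset_affineSpan ℝ _ hx)
  · simpa using hδ t

end FacetDescription

section Boxes

variable {r : ℕ} {n : Fin r → ℕ}

/-- A nonempty combinatorial box `∏ A i` with `A i ⊆ Fin (n i + 1)`; these index the nonempty faces
of a product of simplices. -/
abbrev Box (n : Fin r → ℕ) : Type :=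
  {A : (i : Fin r) → Finset (Fin (n i + 1)) // ∀ i, (A i).Nonempty}

namespace Box

/-- The dimension of the face of the product of simplices indexed by a box. -/
def dim (B : Box n) : ℕ := ∑ i, ((B.1 i).card - 1)

/-- The box with a single vertex. -/
def point (v : (i : Fin r) → Fin (n i + 1)) : Box n :=
  ⟨fun i => {v i}, fun _ => Finset.singleton_nonempty _⟩

/-- The smallest box containing two vertices. -/
def span (u v : (i : Fin r) → Fin (n i + 1)) : Box n :=
  ⟨fun i => {u i, v i}, fun _ => Finset.insert_nonempty _ _⟩

theorem dim_mono {A B : Box n} (h : A ≤ B) : A.dim ≤ B.dim :=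
  Finset.sum_le_sum fun i _ => Nat.sub_le_sub_right (Finset.card_le_card (h i)) 1

theorem point_le {v : (i : Fin r) → Fin (n i + 1)} {B : Box n} :
    point v ≤ B ↔ ∀ i, v i ∈ B.1 i := by
  change (∀ i, {v i} ⊆ B.1 i) ↔ _
  simp

theorem exists_point_le (B : Box n) : ∃ v, point v ≤ B := by
  choose v hv using B.2
  exact ⟨v, point_le.2 hv⟩

theorem exists_point_le_of_mem (B : Box n) {i : Fin r} {a : Fin (n i + 1)} (ha : a ∈ B.1 i) :
    ∃ v, point v ≤ B ∧ v i = a := by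
  obtain ⟨v, hv⟩ := B.exists_point_le
  refine ⟨Function.update v i a, point_le.2 fun j => ?_, Function.update_self ..⟩
  by_cases h : j = i
  · subst h; simpa using ha
  · simpa [h] using point_le.1 hv j

theorem le_of_points {A B : Box n} (h : ∀ v, point v ≤ A → point v ≤ B) : A ≤ B := by
  intro i a ha
  obtain ⟨v, hv, rfl⟩ := A.exists_point_le_of_mem ha
  exact point_le.1 (h v hv) i

theorem point_le_point {u v : (i : Fin r) → Fin (n i + 1)} : point u ≤ point v ↔ u = v := by
  rw [point_le, funext_iff]
  simp [point]

theorem dim_point (v : (i : Fin r) → Fin (n i + 1)) : (point v).dim = 0 := by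
  simp [dim, point]

theorem eq_point_of_dim_eq_zero {B : Box n} (h : B.dim = 0) : ∃ v, B = point v := by
  obtain ⟨v, hv⟩ := B.exists_point_le
  refine ⟨v, le_antisymm (fun i a ha => ?_) hv⟩
  have h1 : (B.1 i).card - 1 = 0 := Finset.sum_eq_zero_iff.1 h i (Finset.mem_univ i)
  have h2 := Finset.card_le_one.1 (by omega) a ha _ (point_le.1 hv i)
  simp [point, h2]

/-- Two vertices are adjacent when they differ in exactly one coordinate. -/
def Adj (u v : (i : Fin r) → Fin (n i + 1)) : Prop :=
  ∃ i a, a ≠ u i ∧ v = Function.update u i a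

theorem dim_span_of_adj {u v : (i : Fin r) → Fin (n i + 1)} (h : Adj u v) :
    (span u v).dim = 1 := by
  obtain ⟨i, a, ha, rfl⟩ := h
  rw [dim, Finset.sum_eq_single i]
  · simp [span, Finset.card_pair ha.symm]
  · intro j _ hj
    simp [span, hj]
  · simp

theorem eq_or_eq_of_le_span {u v w : (i : Fin r) → Fin (n i + 1)} (h : Adj u v)
    (hw : point w ≤ span u v) : w = u ∨ w = v := by
  obtain ⟨i, a, ha, rfl⟩ := h
  rw [point_le] at hw
  have hj : ∀ j, j ≠ i → w j = u j := fun j hj => by simpa [span, hj] using hw j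
  have hi : w i = u i ∨ w i = a := by simpa [span] using hw i
  refine hi.imp (fun h => funext fun j => ?_) (fun h => funext fun j => ?_)
  · by_cases hji : j = i
    · subst hji; exact h
    · exact hj j hji
  · by_cases hji : j = i
    · subst hji; simpa using h
    · simpa [hji] using hj j hji

theorem adj_of_le_span {u v : (i : Fin r) → Fin (n i + 1)} (hne : u ≠ v)
    (h : ∀ w, point w ≤ span u v → w = u ∨ w = v) : Adj u v := by
  obtain ⟨i, hi⟩ := Function.ne_iff.1 hne
  have hmem : point (Function.update u i (v i)) ≤ span u v := point_le.2 fun j => by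
    by_cases hji : j = i
    · subst hji; simp [span]
    · simp [span, hji]
  refine ⟨i, v i, hi.symm, (h _ hmem).elim (fun h1 => ?_) Eq.symm⟩
  exact absurd (by simpa using congrFun h1 i) hi.symm

/-- The dimension of a box is the degree of any of its vertices in its graph. -/
theorem ncard_adj {B : Box n} {v : (i : Fin r) → Fin (n i + 1)} (hv : point v ≤ B) :
    {w | Adj v w ∧ point w ≤ B}.ncard = B.dim := by
  classical
  rw [point_le] at hv
  have hset : {w | Adj v w ∧ point w ≤ B} =
      ((Finset.univ.sigma fun i => (B.1 i).erase (v i)).image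
        fun p => Function.update v p.1 p.2 : Finset _) := by
    ext w
    simp only [mem_ofPred_eq, Finset.coe_image, mem_image, Finset.mem_coe, Finset.mem_sigma,
      Finset.mem_univ, true_and, Finset.mem_erase, point_le]
    constructor
    · rintro ⟨⟨i, a, ha, rfl⟩, hw⟩
      exact ⟨⟨i, a⟩, ⟨ha, by simpa using hw i⟩, rfl⟩
    · rintro ⟨⟨i, a⟩, ⟨ha, haB⟩, rfl⟩
      refine ⟨⟨i, a, ha, rfl⟩, fun j => ?_⟩
      by_cases hji : j = i
      · subst hji; simpa using haB
      · simpa [hji] using hv j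
  rw [hset, ncard_coe_finset, Finset.card_image_of_injOn, Finset.card_sigma, dim]
  · exact Finset.sum_congr rfl fun i _ => Finset.card_erase_of_mem (hv i)
  · rintro ⟨i, a⟩ hia ⟨j, b⟩ hjb heq
    simp only [Finset.coe_sigma, Finset.mem_coe,
      Set.mem_sigma_iff, Finset.coe_univ, mem_univ, true_and, Finset.coe_erase, mem_sdiff,
      mem_singleton_iff] at hia hjb
    dsimp only at heq
    have hij : i = j := by
      by_contra hne
      have := congrFun heq i
      rw [Function.update_self, Function.update_of_ne hne] at this
      exact hia.2 this
    subst hij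
    have := congrFun heq i
    rw [Function.update_self, Function.update_self] at this
    rw [this]

/-- An order embedding of the boxes of dimension at most `k` into all boxes, which sends distinct
vertices to disjoint boxes, has image the set of boxes of dimension at most `k`. -/
theorem exists_eq_of_orderEmbedding {k : ℕ} (φ : {B : Box n // B.dim ≤ k} ↪o Box n)
    (hdisj : ∀ (u v : (i : Fin r) → Fin (n i + 1)) (hu : (point u).dim ≤ k)
      (hv : (point v).dim ≤ k) (C : Box n), C ≤ φ ⟨point u, hu⟩ → C ≤ φ ⟨point v, hv⟩ → u = v)
    (B : Box n) (hB : B.dim ≤ k) : ∃ A, φ A = B := by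
  have h0 : ∀ u : (i : Fin r) → Fin (n i + 1), (point u).dim ≤ k := fun u => by
    rw [dim_point]; exact Nat.zero_le _
  choose σ hσ using fun u => (φ ⟨point u, h0 u⟩).exists_point_le
  have hσinj : Function.Injective σ := fun u v huv =>
    hdisj u v (h0 u) (h0 v) _ (hσ u) (huv ▸ hσ v)
  have hσsurj : Function.Surjective σ := Finite.surjective_of_injective hσinj
  have hφσ : ∀ u, φ ⟨point u, h0 u⟩ = point (σ u) := fun u => by
    refine le_antisymm (le_of_points fun w hw => ?_) (hσ u)
    obtain ⟨u', rfl⟩ := hσsurj w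
    rw [hdisj u' u (h0 u') (h0 u) _ (hσ u') hw]
  have hmem : ∀ (u) (A : {B : Box n // B.dim ≤ k}), point (σ u) ≤ φ A ↔ point u ≤ A.1 :=
    fun u A => by rw [← hφσ, φ.le_iff_le]; rfl
  have hdim : ∀ A, (φ A).dim = A.1.dim := by
    intro A
    by_cases hk : k = 0
    · obtain ⟨A, hA⟩ := A
      subst hk
      obtain ⟨v, rfl⟩ := eq_point_of_dim_eq_zero (Nat.le_zero.1 hA)
      rw [hφσ, dim_point, dim_point]
    have hadj : ∀ u v, Adj u v → Adj (σ u) (σ v) := by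
      intro u v huv
      have hle : (span u v).dim ≤ k := by rw [dim_span_of_adj huv]; omega
      have huv' : u ≠ v := by
        obtain ⟨i, a, ha, rfl⟩ := huv
        exact fun h => ha (by simpa using (congrFun h i).symm)
      refine adj_of_le_span (hσinj.ne huv') fun w hw => ?_
      have hspan : span (σ u) (σ v) ≤ φ ⟨span u v, hle⟩ := by
        have h1 := (hmem u ⟨span u v, hle⟩).2 (point_le.2 fun i => by simp [span])
        have h2 := (hmem v ⟨span u v, hle⟩).2 (point_le.2 fun i => by simp [span])
        intro i a ha
        simp only [span, Finset.mem_insert, Finset.mem_singleton] at ha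
        rcases ha with rfl | rfl
        · exact point_le.1 h1 i
        · exact point_le.1 h2 i
      obtain ⟨w, rfl⟩ := hσsurj w
      exact (eq_or_eq_of_le_span huv ((hmem w _).1 (hw.trans hspan))).imp
        (congrArg σ) (congrArg σ)
    have hadj' : ∀ u v, Adj (σ u) (σ v) → Adj u v := by
      let s := {p : ((i : Fin r) → Fin (n i + 1)) × ((i : Fin r) → Fin (n i + 1)) | Adj p.1 p.2}
      have hmaps : MapsTo (Prod.map σ σ) s s := fun p hp => hadj _ _ hp
      have hsurj : SurjOn (Prod.map σ σ) s s :=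
        (eq_of_subset_of_ncard_le hmaps.image_subset
          (ncard_image_of_injective s (hσinj.prodMap hσinj)).ge).ge
      intro u v huv
      obtain ⟨⟨u', v'⟩, hp, heq⟩ := hsurj (show (σ u, σ v) ∈ s from huv)
      simp only [Prod.map_apply, Prod.mk.injEq] at heq
      rw [← hσinj heq.1, ← hσinj heq.2]
      exact hp
    obtain ⟨v, hv⟩ := A.1.exists_point_le
    rw [← ncard_adj hv, ← ncard_adj ((hmem v A).2 hv), 
      ← ncard_image_of_injective {w | Adj v w ∧ point w ≤ A.1} hσinj]
    congr 1
    ext w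
    constructor
    · rintro ⟨h1, h2⟩
      obtain ⟨w, rfl⟩ := hσsurj w
      exact ⟨w, ⟨hadj' _ _ h1, (hmem w A).1 h2⟩, rfl⟩
    · rintro ⟨w, ⟨h1, h2⟩, rfl⟩
      exact ⟨hadj _ _ h1, (hmem w A).2 h2⟩
  let ψ : {B : Box n // B.dim ≤ k} → {B : Box n // B.dim ≤ k} :=
    fun A => ⟨φ A, (hdim A).trans_le A.2⟩
  have hψ : Function.Injective ψ := fun A A' h => φ.injective (congrArg Subtype.val h)
  obtain ⟨A, hA⟩ := Finite.surjective_of_injective hψ ⟨B, hB⟩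
  exact ⟨A, congrArg Subtype.val hA⟩

/-- The box of all vertices whose `i`-th coordinate differs from `a`. -/
def facet (hn : ∀ i, 1 ≤ n i) (t : (i : Fin r) × Fin (n i + 1)) : Box n :=
  ⟨fun j => Finset.univ.filter fun b => (⟨j, b⟩ : (i : Fin r) × Fin (n i + 1)) ≠ t, fun j => by
    have : Nontrivial (Fin (n j + 1)) := Fin.nontrivial_iff_two_le.2 (by have := hn j; omega)
    by_cases h : j = t.1
    · obtain ⟨i, a⟩ := t
      subst h
      obtain ⟨b, hb⟩ := exists_ne a
      exact ⟨b, by simpa using hb⟩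
    · exact ⟨0, by simpa using fun h' => h (congrArg Sigma.fst h')⟩⟩

theorem le_facet_iff (hn : ∀ i, 1 ≤ n i) {t : (i : Fin r) × Fin (n i + 1)} {B : Box n} :
    B ≤ facet hn t ↔ t.2 ∉ B.1 t.1 := by
  change (∀ i, B.1 i ⊆ (facet hn t).1 i) ↔ _
  constructor
  · intro h ht
    simpa [facet] using h _ ht
  · intro h i a ha
    simp only [facet, Finset.mem_filter, Finset.mem_univ, true_and]
    rintro rfl
    exact h ha

instance : Top (Box n) := ⟨⟨fun _ => Finset.univ, fun _ => Finset.univ_nonempty⟩⟩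

theorem mem_top (i : Fin r) (a : Fin (n i + 1)) : a ∈ (⊤ : Box n).1 i := Finset.mem_univ a

theorem le_top' (B : Box n) : B ≤ ⊤ := fun i a _ => mem_top i a

theorem dim_top : (⊤ : Box n).dim = ∑ i, n i :=
  Finset.sum_congr rfl fun i _ => by
    change (Finset.univ : Finset (Fin (n i + 1))).card - 1 = n i
    simp

theorem exists_le_facet (hn : ∀ i, 1 ≤ n i) {B : Box n} (h : B ≠ ⊤) :
    ∃ t, B ≤ facet hn t := by
  by_contra! hcon
  refine h (le_antisymm B.le_top' fun i a _ => ?_)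
  by_contra ha
  exact hcon ⟨i, a⟩ ((le_facet_iff hn).2 ha)

/-- A strictly monotone function on boxes is at least the dimension. -/
theorem dim_le_of_strictMono {h : Box n → ℕ} (hh : StrictMono h) (B : Box n) : B.dim ≤ h B := by
  induction hd : B.dim generalizing B with
  | zero => exact Nat.zero_le _
  | succ d ih =>
    obtain ⟨i, hi⟩ : ∃ i, 1 < (B.1 i).card := by
      by_contra! hcon
      have : B.dim = 0 := Finset.sum_eq_zero fun i _ => by have := hcon i; omega
      omega
    obtain ⟨a, ha⟩ := B.2 i
    let A : Box n := ⟨Function.update B.1 i ((B.1 i).erase a), fun j => by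
      by_cases hj : j = i
      · subst hj
        rw [Function.update_self, ← Finset.card_pos, Finset.card_erase_of_mem ha]
        omega
      · rw [Function.update_of_ne hj]; exact B.2 j⟩
    have hAB : A < B := by
      refine lt_of_le_of_ne (fun j => ?_) fun h => ?_
      · by_cases hj : j = i
        · subst hj
          simp only [A, Function.update_self]
          exact Finset.erase_subset _ _
        · simp only [A, Function.update_of_ne hj]
          exact le_rfl
      · rw [← h] at ha
        simp [A] at ha
    have hA : A.dim = d := by
      rw [dim, ← Finset.add_sum_erase _ _ (Finset.mem_univ i)] at hd ⊢
      have h1 : ∀ j ∈ Finset.univ.erase i, (A.1 j).card - 1 = (B.1 j).card - 1 := fun j hj => by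
        simp only [A, Function.update_of_ne (Finset.ne_of_mem_erase hj)]
      rw [Finset.sum_congr rfl h1]
      have h2 : (A.1 i).card = (B.1 i).card - 1 := by
        simp only [A, Function.update_self]
        exact Finset.card_erase_of_mem ha
      omega
    exact Nat.succ_le_of_lt ((ih A hA).trans_lt (hh hAB))

/-- If every set of coordinates missed by a box of dimension at most `k` contains both a positive
and a negative value of `g`, then `k + 1` is a subset sum of `n`. -/
theorem exists_sum_eq_of_signs {k : ℕ} (hsum : 2 * (k + 1) = ∑ i, n i) (hn : ∀ i, 1 ≤ n i)
    (g : (i : Fin r) × Fin (n i + 1) → ℝ)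
    (hpos : ∀ B : Box n, B.dim ≤ k → ∃ t, t.2 ∉ B.1 t.1 ∧ 0 < g t)
    (hneg : ∀ B : Box n, B.dim ≤ k → ∃ t, t.2 ∉ B.1 t.1 ∧ g t < 0) :
    ∃ T : Finset (Fin r), ∑ i ∈ T, n i = k + 1 := by
  classical
  have key : ∀ p : (i : Fin r) × Fin (n i + 1) → Prop,
      (∀ B : Box n, B.dim ≤ k → ∃ t, t.2 ∉ B.1 t.1 ∧ p t) →
      k + 1 ≤ ∑ i, ((Finset.univ.filter fun a => p ⟨i, a⟩).card - 1) := by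
    intro p hp
    by_contra! hlt
    let B : Box n := ⟨fun i => if (Finset.univ.filter fun a => p ⟨i, a⟩).Nonempty then
      Finset.univ.filter fun a => p ⟨i, a⟩ else {0}, fun i => by
        dsimp only
        split_ifs with h
        · exact h
        · exact Finset.singleton_nonempty _⟩
    have hBdim : B.dim = ∑ i, ((Finset.univ.filter fun a => p ⟨i, a⟩).card - 1) := by
      refine Finset.sum_congr rfl fun i _ => ?_
      simp only [B]
      split_ifs with h
      · rfl
      · rw [Finset.not_nonempty_iff_eq_empty.1 h]; rfl
    obtain ⟨⟨i, a⟩, hta, hpt⟩ := hp B (by omega)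
    refine hta ?_
    have ha : a ∈ Finset.univ.filter fun a => p ⟨i, a⟩ := by simpa using hpt
    simp only [B]
    rw [if_pos ⟨a, ha⟩]
    exact ha
  set P : Fin r → ℕ := fun i => (Finset.univ.filter fun a => 0 < g ⟨i, a⟩).card with hP
  set N : Fin r → ℕ := fun i => (Finset.univ.filter fun a => g ⟨i, a⟩ < 0).card with hN
  have h1 : k + 1 ≤ ∑ i, (P i - 1) := key _ hpos
  have h2 : k + 1 ≤ ∑ i, (N i - 1) := key _ hneg
  have hPN : ∀ i, P i + N i ≤ n i + 1 := fun i => by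
    rw [hP, hN, ← Finset.card_union_of_disjoint]
    · exact (Finset.card_le_univ _).trans_eq (Fintype.card_fin _)
    · rw [Finset.disjoint_filter]
      intro a _ h h'
      exact lt_asymm h h'
  have hle : ∀ i ∈ Finset.univ, (P i - 1) + (N i - 1) ≤ n i := fun i _ => by
    have := hPN i; have := hn i; omega
  have hsum_le := Finset.sum_le_sum hle
  rw [Finset.sum_add_distrib] at hsum_le
  have heq : ∀ i ∈ Finset.univ, (P i - 1) + (N i - 1) = n i := by
    rw [← Finset.sum_eq_sum_iff_of_le hle, Finset.sum_add_distrib]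
    omega
  refine ⟨Finset.univ.filter fun i => N i = 0, ?_⟩
  rw [Finset.sum_filter]
  have : ∀ i ∈ Finset.univ, (if N i = 0 then n i else 0) = P i - 1 := fun i hi => by
    have := heq i hi; have := hPN i; have := hn i
    split_ifs with h <;> omega
  rw [Finset.sum_congr rfl this]
  omega

end Box

end Boxes

section ProdSimplexFaces

variable {r : ℕ} {n : Fin r → ℕ}

/-- The vertex of the product of simplices indexed by `v`. -/
def simplexVertex (v : (i : Fin r) → Fin (n i + 1)) : (i : Fin r) → Fin (n i + 1) → ℝ :=
  fun i => Pi.single (v i) 1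

/-- The face of the product of simplices indexed by a box. -/
def boxFace (B : Box n) : Set ((i : Fin r) → Fin (n i + 1) → ℝ) :=
  {x ∈ prodSimplex n | ∀ i, ∀ a ∉ B.1 i, x i a = 0}

theorem simplexVertex_mem (v : (i : Fin r) → Fin (n i + 1)) :
    simplexVertex v ∈ prodSimplex n :=
  fun i _ => single_mem_stdSimplex ℝ (v i)

theorem simplexVertex_mem_boxFace {v : (i : Fin r) → Fin (n i + 1)} {B : Box n} :
    simplexVertex v ∈ boxFace B ↔ Box.point v ≤ B := by
  rw [Box.point_le]
  constructor
  · intro h i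
    by_contra hi
    simpa [simplexVertex] using h.2 i (v i) hi
  · refine fun h => ⟨simplexVertex_mem v, fun i a ha => ?_⟩
    have : a ≠ v i := fun h' => ha (h' ▸ h i)
    simp [simplexVertex, this]

theorem boxFace_subset_boxFace {A B : Box n} : boxFace A ⊆ boxFace B ↔ A ≤ B := by
  refine ⟨fun h => Box.le_of_points fun v hv => ?_, fun h x hx => ⟨hx.1, fun i a ha => ?_⟩⟩
  · exact simplexVertex_mem_boxFace.1 (h (simplexVertex_mem_boxFace.2 hv))
  · exact hx.2 i a fun ha' => ha (h i ha')

theorem boxFace_nonempty (B : Box n) : (boxFace B).Nonempty := by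
  obtain ⟨v, hv⟩ := B.exists_point_le
  exact ⟨_, simplexVertex_mem_boxFace.2 hv⟩

theorem boxFace_top : boxFace (⊤ : Box n) = prodSimplex n :=
  Subset.antisymm (fun _ hx => hx.1) fun _ hx => ⟨hx, fun i a ha => absurd (Box.mem_top i a) ha⟩

theorem sum_mul_le_of_mem_prodSimplex {γ : (i : Fin r) → Fin (n i + 1) → ℝ} {m : Fin r → ℝ}
    (hγ : ∀ i a, γ i a ≤ m i) {x : (i : Fin r) → Fin (n i + 1) → ℝ} (hx : x ∈ prodSimplex n) :
    ∑ i, ∑ a, γ i a * x i a ≤ ∑ i, m i ∧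
      (∑ i, ∑ a, γ i a * x i a = ∑ i, m i ↔ ∀ i a, γ i a ≠ m i → x i a = 0) := by
  have hx0 : ∀ i a, 0 ≤ x i a := fun i => (hx i trivial).1
  have hx1 : ∀ i, ∑ a, x i a = 1 := fun i => (hx i trivial).2
  have hm : ∑ i, m i = ∑ i, ∑ a, m i * x i a := by simp [← Finset.mul_sum, hx1]
  have hle : ∀ i a, γ i a * x i a ≤ m i * x i a := fun i a =>
    mul_le_mul_of_nonneg_right (hγ i a) (hx0 i a)
  have hle' : ∀ i ∈ Finset.univ, ∑ a, γ i a * x i a ≤ ∑ a, m i * x i a := fun i _ =>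
    Finset.sum_le_sum fun a _ => hle i a
  rw [hm]
  refine ⟨Finset.sum_le_sum hle', ?_⟩
  rw [Finset.sum_eq_sum_iff_of_le hle']
  refine forall_congr' fun i => ?_
  rw [Finset.sum_eq_sum_iff_of_le fun a _ => hle i a]
  simp [or_iff_not_imp_left]

theorem isFace_boxFace (B : Box n) : IsFace (prodSimplex n) (boxFace B) := by
  classical
  let γ : (i : Fin r) → Fin (n i + 1) → ℝ := fun i a => if a ∈ B.1 i then 1 else 0
  have hγ : ∀ i a, γ i a ≤ 1 := fun i a => by
    simp only [γ]; split_ifs <;> norm_num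
  let c : ((i : Fin r) → Fin (n i + 1) → ℝ) →ₗ[ℝ] ℝ :=
    ∑ i, ∑ a, γ i a •
      ((LinearMap.proj a : (Fin (n i + 1) → ℝ) →ₗ[ℝ] ℝ) ∘ₗ LinearMap.proj i)
  have hc : ∀ x, c x = ∑ i, ∑ a, γ i a * x i a := fun x => by simp [c]
  refine isFace_of_functional (boxFace_nonempty B) (fun x hx => hx.1) c (∑ _i : Fin r, 1)
    (fun x hx => ?_) fun x hx => ?_
  · rw [hc]; exact (sum_mul_le_of_mem_prodSimplex hγ hx).1
  · rw [hc, (sum_mul_le_of_mem_prodSimplex hγ hx).2]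
    simp [boxFace, hx, γ]

theorem exists_eq_boxFace {F : Set ((i : Fin r) → Fin (n i + 1) → ℝ)}
    (hF : IsFace (prodSimplex n) F) : ∃ B, boxFace B = F := by
  classical
  obtain ⟨-, c, rfl⟩ := hF
  let γ : (i : Fin r) → Fin (n i + 1) → ℝ := fun i a => c (Pi.single i (Pi.single a 1))
  have hc : ∀ x, c x = ∑ i, ∑ a, γ i a * x i a := fun x => by
    conv_lhs => rw [← Finset.univ_sum_single x]
    rw [map_sum]
    refine Finset.sum_congr rfl fun i _ => ?_
    conv_lhs => rw [← Finset.univ_sum_single (x i)]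
    have := map_sum (c ∘ₗ LinearMap.single ℝ (fun i => Fin (n i + 1) → ℝ) i)
      (fun a => Pi.single a (x i a)) Finset.univ
    simp only [LinearMap.comp_apply, LinearMap.single_apply] at this
    rw [this]
    refine Finset.sum_congr rfl fun a _ => ?_
    have h1 : Pi.single i (Pi.single a (x i a)) =
        x i a • (Pi.single i (Pi.single a 1) : (i : Fin r) → Fin (n i + 1) → ℝ) := by
      rw [← Pi.single_smul, ← Pi.single_smul, smul_eq_mul, mul_one]
    rw [h1, map_smul, smul_eq_mul, mul_comm]
  choose v hv using fun i => Finite.exists_max (γ i)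
  let B : Box n := ⟨fun i => Finset.univ.filter fun a => γ i a = γ i (v i), fun i =>
    ⟨v i, by simp⟩⟩
  have hmem : ∀ x ∈ prodSimplex n, x ∈ boxFace B ↔ c x = ∑ i, γ i (v i) := fun x hx => by
    rw [hc, (sum_mul_le_of_mem_prodSimplex hv hx).2]
    simp [boxFace, hx, B]
  have hvB : simplexVertex v ∈ boxFace B :=
    simplexVertex_mem_boxFace.2 (Box.point_le.2 fun i => by simp [B])
  refine ⟨B, Subset.antisymm (fun x hx => ⟨hx.1, fun y hy => ?_⟩) fun x hx => ?_⟩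
  · rw [(hmem x hx.1).1 hx, hc]
    exact (sum_mul_le_of_mem_prodSimplex hv hy).1
  · refine (hmem x hx.1).2 (le_antisymm ?_ ?_)
    · rw [hc]; exact (sum_mul_le_of_mem_prodSimplex hv hx.1).1
    · rw [← (hmem _ hvB.1).1 hvB]
      exact hx.2 _ hvB.1

theorem polyDim_boxFace (B : Box n) : polyDim (boxFace B) = B.dim := by
  classical
  refine le_antisymm ?_ (Box.dim_le_of_strictMono (h := fun B => polyDim (boxFace B))
    (fun A B hAB => polyDim_lt_of_isFace (isFace_boxFace A) (fun x hx => hx.1)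
      ⟨boxFace_subset_boxFace.2 hAB.le, fun h => hAB.not_ge (boxFace_subset_boxFace.1 h)⟩) B)
  obtain ⟨v, hv⟩ := B.exists_point_le
  rw [Box.point_le] at hv
  let W : Submodule ℝ ((i : Fin r) → Fin (n i + 1) → ℝ) :=
    { carrier := {g | ∀ i, (∀ a ∉ B.1 i, g i a = 0) ∧ ∑ a, g i a = 0}
      add_mem' := fun {g h} hg hh i => ⟨fun a ha => by
        simp [(hg i).1 a ha, (hh i).1 a ha], by simp [Finset.sum_add_distrib, (hg i).2, (hh i).2]⟩
      zero_mem' := fun i => by simp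
      smul_mem' := fun c g hg i => ⟨fun a ha => by simp [(hg i).1 a ha], by
        simp [← Finset.mul_sum, (hg i).2]⟩ }
  have hle : (affineSpan ℝ (boxFace B)).direction ≤ W := by
    rw [direction_affineSpan, vectorSpan_def, Submodule.span_le]
    rintro _ ⟨x, hx, y, hy, rfl⟩
    refine fun i => ⟨fun a ha => ?_, ?_⟩
    · simp [hx.2 i a ha, hy.2 i a ha]
    · simp [(hx.1 i trivial).2, (hy.1 i trivial).2]
  let ρ : W →ₗ[ℝ] ((i : Fin r) → {a // a ∈ (B.1 i).erase (v i)} → ℝ) :=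
    { toFun := fun g i a => g.1 i a
      map_add' := fun _ _ => rfl
      map_smul' := fun _ _ => rfl }
  have hρ : Function.Injective ρ := by
    rw [← LinearMap.ker_eq_bot, LinearMap.ker_eq_bot']
    rintro ⟨g, hg⟩ hg0
    ext i a
    have h0 : ∀ a, a ≠ v i → g i a = 0 := fun a ha => by
      by_cases haB : a ∈ B.1 i
      · exact congrFun (congrFun hg0 i) ⟨a, Finset.mem_erase.2 ⟨ha, haB⟩⟩
      · exact (hg i).1 a haB
    by_cases ha : a = v i
    · subst ha
      have := (hg i).2
      rwa [Finset.sum_eq_single (v i) (fun b _ hb => h0 b hb) (by simp)] at this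
    · exact h0 a ha
  refine ((Submodule.finrank_mono hle).trans (LinearMap.finrank_le_finrank_of_injective hρ)).trans ?_
  rw [Module.finrank_pi_fintype, Box.dim]
  refine Finset.sum_le_sum fun i _ => ?_
  rw [Module.finrank_fintype_fun_eq_card, Fintype.card_coe, Finset.card_erase_of_mem (hv i)]

/-- The face poset of a product of simplices is the poset of boxes. -/
noncomputable def boxFaceIso : Box n ≃o facesOf (prodSimplex n) :=
  RelIso.ofSurjective (OrderEmbedding.ofMapLEIff
    (fun B => (⟨boxFace B, isFace_boxFace B⟩ : facesOf (prodSimplex n)))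
    fun _ _ => boxFace_subset_boxFace) fun F => by
      obtain ⟨B, hB⟩ := exists_eq_boxFace F.2
      exact ⟨B, Subtype.ext hB⟩

/-- The `k`-skeleton of a product of simplices is the poset of boxes of dimension at most `k`. -/
noncomputable def boxSkelIso (k : ℕ) : {B : Box n // B.dim ≤ k} ≃o skel k (prodSimplex n) :=
  RelIso.ofSurjective (OrderEmbedding.ofMapLEIff
    (fun B => (⟨boxFace B.1, isFace_boxFace B.1, (polyDim_boxFace B.1).trans_le B.2⟩ :
      skel k (prodSimplex n)))
    fun _ _ => boxFace_subset_boxFace) fun F => by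
      obtain ⟨B, hB⟩ := exists_eq_boxFace F.2.1
      exact ⟨⟨B, by rw [← polyDim_boxFace, hB]; exact F.2.2⟩, Subtype.ext hB⟩

theorem isPolytope_prodSimplex : IsPolytope (prodSimplex n) := by
  classical
  refine ⟨(finite_range (simplexVertex (n := n))).toFinset, ?_⟩
  rw [Finite.coe_toFinset]
  have h : range (simplexVertex (n := n)) =
      univ.pi fun i => range fun a : Fin (n i + 1) => (Pi.single a 1 : Fin (n i + 1) → ℝ) := by
    ext x
    simp only [mem_range, mem_univ_pi]
    exact ⟨by rintro ⟨v, rfl⟩ i; exact ⟨v i, rfl⟩, fun h => by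
      choose v hv using h
      exact ⟨v, funext hv⟩⟩
  rw [h, convexHull_pi]
  simp only [convexHull_rangle_single_eq_stdSimplex]
  rfl

end ProdSimplexFaces

section Projections

variable {r : ℕ} {n : Fin r → ℕ}

theorem IsFace.image_equiv {E E' : Type*} [AddCommGroup E] [Module ℝ E] [AddCommGroup E']
    [Module ℝ E'] (L : E ≃ₗ[ℝ] E') {P F : Set E} (hF : IsFace P F) :
    IsFace (L '' P) (L '' F) := by
  obtain ⟨c, m, hc, hc'⟩ := hF.exists_functional
  refine isFace_of_functional (hF.1.image L) (image_mono hF.subset) (c ∘ₗ L.symm.toLinearMap) m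
    ?_ ?_
  · rintro _ ⟨x, hx, rfl⟩
    simpa using hc x hx
  · rintro _ ⟨x, hx, rfl⟩
    rw [L.injective.mem_set_image, hc' x hx]
    simp

/-- A linear equivalence induces an isomorphism of face posets. -/
noncomputable def facesOfImageEquiv {E E' : Type*} [AddCommGroup E] [Module ℝ E]
    [AddCommGroup E'] [Module ℝ E'] (L : E ≃ₗ[ℝ] E') (P : Set E) :
    facesOf P ≃o facesOf (L '' P) :=
  RelIso.ofSurjective (OrderEmbedding.ofMapLEIff
    (fun F => (⟨L '' F.1, IsFace.image_equiv L F.2⟩ : facesOf (L '' P)))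
    fun _ _ => image_subset_image_iff L.injective) fun F => by
      refine ⟨⟨L.symm '' F.1, ?_⟩, Subtype.ext ?_⟩
      · have := IsFace.image_equiv L.symm F.2
        rwa [image_image, show (fun x => L.symm (L x)) '' P = P by simp] at this
      · change L '' (L.symm '' F.1) = F.1
        rw [image_image]
        simp

theorem isPPSN_prodSimplex (k : ℕ) : IsPPSN k n (prodSimplex n) := by
  let L : ((i : Fin r) → Fin (n i + 1) → ℝ) ≃ₗ[ℝ]
      (Fin (Module.finrank ℝ ((i : Fin r) → Fin (n i + 1) → ℝ)) → ℝ) :=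
    LinearEquiv.ofFinrankEq _ _ (Module.finrank_fin_fun ℝ).symm
  refine ⟨⟨isPolytope_prodSimplex, ⟨OrderIso.refl _⟩⟩, _, L '' prodSimplex n,
    L.symm.toLinearMap, ?_, ?_, ⟨(facesOfImageEquiv L _).symm⟩⟩
  · classical
    obtain ⟨V, hV⟩ := isPolytope_prodSimplex (n := n)
    refine ⟨V.image L, ?_⟩
    rw [hV, Finset.coe_image]
    exact L.toLinearMap.image_convexHull _
  · simp [image_image]

theorem polyDim_prodSimplex : polyDim (prodSimplex n) = ∑ i, n i := by
  rw [← boxFace_top, polyDim_boxFace, Box.dim_top]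

variable {E E' : Type*} [AddCommGroup E] [Module ℝ E] [AddCommGroup E'] [Module ℝ E']

theorem IsFace.self {P F : Set E} (hF : IsFace P F) : IsFace P P :=
  isFace_of_functional (hF.1.mono hF.subset) Subset.rfl 0 0 (fun _ _ => le_rfl) (by simp)

theorem coe_faceIso_top {Q : Set E} (e : Box n ≃o facesOf Q) : (e ⊤ : Set E) = Q := by
  refine Subset.antisymm (IsFace.subset (e ⊤).2) ?_
  have h : e (e.symm ⟨Q, IsFace.self (e ⊤).2⟩) ≤ e ⊤ := e.monotone (Box.le_top' _)
  rwa [e.apply_symm_apply] at h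

theorem sum_le_polyDim [FiniteDimensional ℝ E] {Q : Set E} (e : Box n ≃o facesOf Q) :
    ∑ i, n i ≤ polyDim Q := by
  have h := Box.dim_le_of_strictMono (h := fun B => polyDim (e B : Set E))
    (fun A B hAB => polyDim_lt_of_isFace (e A).2 (IsFace.subset (e B).2)
      (e.strictMono hAB)) ⊤
  rwa [Box.dim_top, coe_faceIso_top] at h

/-- If a projection of a combinatorial product of simplices has the same `k`-skeleton, then every
face of dimension at most `k` is a union of fibres of the projection. -/
theorem mem_face_of_map_eq [FiniteDimensional ℝ E'] {k : ℕ} {Q : Set E} {f : E →ₗ[ℝ] E'}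
    (e : Box n ≃o facesOf Q) (K : skel k (f '' Q) ≃o skel k (prodSimplex n)) {B : Box n}
    (hB : B.dim ≤ k) {x y : E} (hx : x ∈ (e B : Set E)) (hy : y ∈ Q) (hxy : f y = f x) :
    y ∈ (e B : Set E) := by
  let κ : {B : Box n // B.dim ≤ k} ≃o skel k (f '' Q) := (boxSkelIso k).trans K.symm
  let pre : skel k (f '' Q) → facesOf Q := fun F => ⟨Q ∩ f ⁻¹' F.1, IsFace.preimage f F.2.1⟩
  have hpre : ∀ F G, pre F ≤ pre G ↔ F ≤ G := by
    intro F G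
    refine ⟨fun h p hp => ?_, fun h p hp => ⟨hp.1, h hp.2⟩⟩
    obtain ⟨q, hq, rfl⟩ := IsFace.subset F.2.1 hp
    exact (h ⟨hq, hp⟩ : q ∈ Q ∩ f ⁻¹' G.1).2
  let φ : {B : Box n // B.dim ≤ k} ↪o Box n :=
    OrderEmbedding.ofMapLEIff (fun A => e.symm (pre (κ A))) fun A A' => by
      rw [e.symm.le_iff_le, hpre, κ.le_iff_le]
  obtain ⟨A, rfl⟩ := Box.exists_eq_of_orderEmbedding φ (by
    intro u v hu hv C hCu hCv
    have hCu' : e C ≤ pre (κ ⟨_, hu⟩) := e.le_symm_apply.1 hCu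
    have hCv' : e C ≤ pre (κ ⟨_, hv⟩) := e.le_symm_apply.1 hCv
    obtain ⟨p, hp⟩ := (e C).2.1
    let D : skel k (f '' Q) := ⟨(κ ⟨_, hu⟩).1 ∩ (κ ⟨_, hv⟩).1,
      (κ ⟨_, hu⟩).2.1.inter (κ ⟨_, hv⟩).2.1 ⟨f p, (hCu' hp).2, (hCv' hp).2⟩,
      (polyDim_mono inter_subset_left).trans (κ ⟨_, hu⟩).2.2⟩
    have hDu : D ≤ κ ⟨_, hu⟩ := fun _ h => h.1
    have hDv : D ≤ κ ⟨_, hv⟩ := fun _ h => h.2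
    rw [← κ.symm_apply_le] at hDu hDv
    obtain ⟨w, hw⟩ := (κ.symm D).1.exists_point_le
    exact (Box.point_le_point.1 (hw.trans hDu)).symm.trans
      (Box.point_le_point.1 (hw.trans hDv))) B hB
  have hφ : e (φ A) = pre (κ A) := e.apply_symm_apply _
  rw [hφ] at hx ⊢
  exact ⟨hy, by rw [mem_preimage, hxy]; exact hx.2⟩

end Projections

section DimensionBound

variable {r : ℕ} {n : Fin r → ℕ} {E E' : Type*} [AddCommGroup E'] [Module ℝ E']
  [NormedAddCommGroup E] [NormedSpace ℝ E] [FiniteDimensional ℝ E]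

/-- If the faces of dimension at most `k` of a combinatorial product of simplices are unions of
fibres of a linear map, then the map is injective on these faces. -/
theorem eq_of_map_eq {k : ℕ} (hn : ∀ i, 1 ≤ n i) {Q : Set E} (hQ : IsCompact Q) (f : E →ₗ[ℝ] E')
    (e : Box n ≃o facesOf Q)
    (hpres : ∀ B : Box n, B.dim ≤ k → ∀ x ∈ (e B : Set E), ∀ y ∈ Q,
      f y = f x → y ∈ (e B : Set E))
    (c : (i : Fin r) × Fin (n i + 1) → E →ₗ[ℝ] ℝ) (m : (i : Fin r) × Fin (n i + 1) → ℝ)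
    (hmem : ∀ t, ∀ x ∈ Q, x ∈ (e (Box.facet hn t) : Set E) ↔ c t x = m t)
    (hfeas : ∀ x ∈ Q,
      ∀ w ∈ (affineSpan ℝ (Q)).direction,
      (∀ t, c t x = m t → c t w ≤ 0) → ∃ δ : ℝ, 0 < δ ∧ x + δ • w ∈ Q)
    {B : Box n} (hB : B.dim ≤ k) {x y : E} (hx : x ∈ (e B : Set E))
    (hy : y ∈ Q) (hxy : f y = f x) : y = x := by
  by_contra hne
  have hxQ : x ∈ Q := IsFace.subset (e B).2 hx
  obtain ⟨l, hl⟩ : ∃ l : E →L[ℝ] ℝ, l y ≠ l x := by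
    obtain ⟨l, hl⟩ := geometric_hahn_banach_point_point hne
    exact ⟨l, hl.ne⟩
  have hfcont : IsClosed {z | f z = f x} := by
    have : {z | f z = f x} = (fun z => z - x) ⁻¹' (LinearMap.ker f : Set E) := by
      ext z; simp [sub_eq_zero]
    rw [this]
    exact (LinearMap.ker f).closed_of_finiteDimensional.preimage (by fun_prop)
  have hcomp : IsCompact (Q ∩ {z | f z = f x}) :=
    hQ.inter_right hfcont
  obtain ⟨p, ⟨hpQ, hpf⟩, hp⟩ := hcomp.exists_isMaxOn ⟨x, hxQ, rfl⟩ l.continuous.continuousOn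
  obtain ⟨q, ⟨hqQ, hqf⟩, hq⟩ := hcomp.exists_isMinOn ⟨x, hxQ, rfl⟩ l.continuous.continuousOn
  replace hpf : f p = f x := hpf
  replace hqf : f q = f x := hqf
  have hlt : l q < l p := by
    have h1 := hp ⟨hxQ, rfl⟩
    have h2 := hp ⟨hy, hxy⟩
    have h3 := hq ⟨hxQ, rfl⟩
    have h4 := hq ⟨hy, hxy⟩
    simp only [mem_ofPred_eq] at h1 h2 h3 h4
    rcases hl.lt_or_gt with h | h <;> linarith
  have hw : p - q ∈ (affineSpan ℝ Q).direction :=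
    AffineSubspace.vsub_mem_direction (subset_affineSpan ℝ _ hpQ) (subset_affineSpan ℝ _ hqQ)
  obtain ⟨t, htp, ht⟩ : ∃ t, c t p = m t ∧ 0 < c t (p - q) := by
    by_contra! hcon
    obtain ⟨δ, hδ, hmem⟩ := hfeas p hpQ _ hw hcon
    have h1 := hp ⟨hmem, by simp [hpf, hqf]⟩
    simp only [mem_ofPred_eq, map_add, map_smul, map_sub, smul_eq_mul] at h1
    nlinarith
  have hpB : p ∈ (e B : Set E) := hpres B hB x hx p hpQ hpf
  have hpt : p ∈ (e (Box.facet hn t) : Set E) := (hmem t p hpQ).2 htp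
  let G : facesOf Q := ⟨(e B : Set E) ∩ e (Box.facet hn t),
    IsFace.inter (e B).2 (e (Box.facet hn t)).2 ⟨p, hpB, hpt⟩⟩
  have hG : (e.symm G).dim ≤ k :=
    (Box.dim_mono (e.symm_apply_le.2 (inter_subset_left : G.1 ⊆ e B))).trans hB
  have hqG := hpres (e.symm G) hG p (by rw [e.apply_symm_apply]; exact ⟨hpB, hpt⟩) q hqQ
    (hqf.trans hpf.symm)
  rw [e.apply_symm_apply] at hqG
  have hqt := (hmem t q hqQ).1 hqG.2
  rw [map_sub, htp, hqt, sub_self] at ht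
  exact lt_irrefl _ ht

/-- A dimension-lowering projection of a combinatorial product of simplices of dimension
`2 (k + 1)` can preserve the `k`-skeleton only if `k + 1` is a subset sum of the dimensions of the
factors. -/
theorem exists_sum_eq_of_polyDim_lt {k : ℕ} (hr : 1 ≤ r) (hn : ∀ i, 1 ≤ n i)
    (hsum : 2 * (k + 1) = ∑ i, n i) {Q : Set E} (hQ : IsPolytope Q) (f : E →ₗ[ℝ] E')
    (e : Box n ≃o facesOf Q)
    (hpres : ∀ B : Box n, B.dim ≤ k → ∀ x ∈ (e B : Set E), ∀ y ∈ Q,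
      f y = f x → y ∈ (e B : Set E))
    (hdim : polyDim (f '' Q) < ∑ i, n i) :
    ∃ T : Finset (Fin r), ∑ i ∈ T, n i = k + 1 := by
  obtain ⟨w, hw, hw0, hfw⟩ := exists_direction_of_polyDim_lt f _ (hdim.trans_le (sum_le_polyDim e))
  obtain ⟨V, hV⟩ := hQ
  choose c m hle hmem using fun t => (e (Box.facet hn t)).2.exists_functional
  have hnot : ∀ t (B : Box n), t.2 ∈ B.1 t.1 → ∃ x ∈ (e B : Set E), c t x < m t := by
    intro t B ht
    have h : ¬ e B ≤ e (Box.facet hn t) := by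
      rw [e.le_iff_le, Box.le_facet_iff]
      exact not_not.2 ht
    obtain ⟨x, hx, hxt⟩ := not_subset.1 h
    have hxQ := IsFace.subset (e B).2 hx
    exact ⟨x, hx, lt_of_le_of_ne (hle t x hxQ) fun h => hxt ((hmem t x hxQ).2 h)⟩
  have hproper : ∀ t, ∃ x ∈ Q, c t x < m t := fun t => by
    have := hnot t ⊤ (Box.mem_top _ _)
    rwa [coe_faceIso_top] at this
  have hcover : ∀ F, IsFace Q F → F ≠ Q → ∃ t, ∀ x ∈ F, c t x = m t := by
    intro F hF hFQ
    have hne : e.symm ⟨F, hF⟩ ≠ ⊤ := fun h => hFQ (by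
      rw [← coe_faceIso_top e, ← h, e.apply_symm_apply])
    obtain ⟨t, ht⟩ := Box.exists_le_facet hn hne
    have hsub : F ⊆ e (Box.facet hn t) := e.symm_apply_le.1 ht
    exact ⟨t, fun x hx => (hmem t x (hF.subset hx)).1 (hsub hx)⟩
  have hfeas : ∀ x ∈ Q, ∀ w ∈ (affineSpan ℝ Q).direction,
      (∀ t, c t x = m t → c t w ≤ 0) → ∃ δ : ℝ, 0 < δ ∧ x + δ • w ∈ Q :=
    fun x hx w hw => by
      subst hV
      exact exists_add_smul_mem V c m hle hproper hcover hx hw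
  have hconv : Convex ℝ Q := hV ▸ convex_convexHull ℝ _
  have hcomp : IsCompact Q := hV ▸ V.finite_toSet.isCompact_convexHull ℝ
  have key : ∀ w ∈ (affineSpan ℝ Q).direction, w ≠ 0 → f w = 0 → ∀ B : Box n, B.dim ≤ k →
      ∃ t, t.2 ∉ B.1 t.1 ∧ 0 < c t w := by
    intro w hw hw0 hfw B hB
    by_contra! hcon
    have hpt : ∀ t : (i : Fin r) × Fin (n i + 1), ∃ x ∈ (e B : Set E),
        t.2 ∈ B.1 t.1 → c t x < m t := fun t => by
      by_cases ht : t.2 ∈ B.1 t.1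
      · obtain ⟨x, hx, hlt⟩ := hnot t B ht
        exact ⟨x, hx, fun _ => hlt⟩
      · obtain ⟨x, hx⟩ := (e B).2.1
        exact ⟨x, hx, fun h => absurd h ht⟩
    choose p hpB hp using hpt
    let ι := (i : Fin r) × Fin (n i + 1)
    have : Nonempty ι := ⟨⟨⟨0, hr⟩, 0⟩⟩
    have hcard : (0 : ℝ) < Fintype.card ι := by exact_mod_cast Fintype.card_pos
    have hsum1 : ∑ _t : ι, (Fintype.card ι : ℝ)⁻¹ = 1 := by simp [hcard.ne']
    let x : E := ∑ t, (Fintype.card ι : ℝ)⁻¹ • p t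
    have hxB : x ∈ (e B : Set E) := (IsFace.convex hconv (e B).2).sum_mem
      (fun _ _ => (inv_pos.2 hcard).le) hsum1 fun t _ => hpB t
    have hxQ : x ∈ Q := IsFace.subset (e B).2 hxB
    have hx : ∀ t : ι, t.2 ∈ B.1 t.1 → c t x < m t := by
      intro t ht
      have h1 : c t x = ∑ s, (Fintype.card ι : ℝ)⁻¹ * c t (p s) := by simp [x]
      have h2 : m t = ∑ _s : ι, (Fintype.card ι : ℝ)⁻¹ * m t := by
        rw [← Finset.sum_mul, hsum1, one_mul]
      rw [h1, h2]
      refine Finset.sum_lt_sum (fun s _ => ?_) ⟨t, Finset.mem_univ t, ?_⟩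
      · exact mul_le_mul_of_nonneg_left (hle t _ (IsFace.subset (e B).2 (hpB s)))
          (inv_pos.2 hcard).le
      · exact mul_lt_mul_of_pos_left (hp t ht) (inv_pos.2 hcard)
    obtain ⟨δ, hδ, hδQ⟩ := hfeas x hxQ w hw fun t ht =>
      hcon t fun htB => (hx t htB).ne ht
    have heq := eq_of_map_eq hn hcomp f e hpres c m hmem hfeas hB hxB hδQ (by simp [hfw])
    simp [hδ.ne', hw0] at heq
  refine Box.exists_sum_eq_of_signs hsum hn (fun t => c t w) (key w hw hw0 hfw) fun B hB => ?_
  obtain ⟨t, ht, hpos⟩ := key (-w) (neg_mem hw) (neg_ne_zero.2 hw0) (by simp [hfw]) B hB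
  exact ⟨t, ht, by simpa using hpos⟩

end DimensionBound

/-- Remark `betterColoring`. If `2(k+1) = Σ_i n_i` (i.e.
`k = ½ Σ n_i - 1`) and `k+1` is not representable as a sum of a subset of
`{n_1, …, n_r}`, then every `(k,n̄)`-PPSN polytope has dimension at least `Σ_i n_i`;
hence the smallest dimension of a `(k,n̄)`-PPSN polytope equals `Σ_i n_i` (it is
attained by `Δ_n̄` itself). -/
theorem statement17 (k r : ℕ) (hr : 1 ≤ r) (n : Fin r → ℕ) (hn : ∀ i, 1 ≤ n i)
    (hsum : 2 * (k + 1) = ∑ i, n i)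
    (hrep : ¬ ∃ T : Finset (Fin r), ∑ i ∈ T, n i = k + 1) :
    (∀ (d : ℕ) (P : Set (Fin d → ℝ)), IsPPSN k n P → ∑ i, n i ≤ polyDim P) ∧
    (∃ P : Set ((i : Fin r) → Fin (n i + 1) → ℝ), IsPPSN k n P ∧ polyDim P = ∑ i, n i) := by
  refine ⟨fun d P hP => ?_, prodSimplex n, isPPSN_prodSimplex k, polyDim_prodSimplex⟩
  obtain ⟨⟨-, ⟨K⟩⟩, N, Q, f, hQ, rfl, ⟨e⟩⟩ := hP
  by_contra! hlt
  let e' : Box n ≃o facesOf Q := boxFaceIso.trans e.symm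
  exact hrep (exists_sum_eq_of_polyDim_lt hr hn hsum hQ f e'
    (fun B hB x hx y hy hxy => mem_face_of_map_eq e' K hB hx hy hxy) hlt)
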